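/- arXiv:1302.5295 — 2 statements merged into one kernel-verified Lean document; each statement's English description precedes it below -/
import Mathlib

section
/- Let n ≥ 2, 1 < p < ∞, 0 < s < min{1, n/p}, and let G ⊂ ℝⁿ be a John domain with dim_𝒜(∂G) < n − sp. Then for every f ∈ L^p(G), (∫_G |f(x)|^p dist(x,∂G)^{−sp} dx)^{1/p} ≤ C ( ‖f‖_{L^p(G)} + (∫_G∫_G |f(x)−f(y)|^p |x−y|^{−n−sp} dy dx)^{1/p} ), with C depending on n, s, p, and G. -/
open MeasureTheory Metric Set
open scoped ENNReal

noncomputable section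

/-- `G` is a John domain with John constant `β` and John center `x₀`:
every point of `G` is joined to `x₀` by a rectifiable curve (given in its
1-Lipschitz arc-length parametrization) of length at most `β * diam G`
which stays proportionally far away from the boundary. -/
def IsJohnDomain (n : ℕ) (G : Set (EuclideanSpace ℝ (Fin n))) (β : ℝ)
    (x₀ : EuclideanSpace ℝ (Fin n)) : Prop :=
  IsOpen G ∧ IsConnected G ∧ Bornology.IsBounded G ∧ x₀ ∈ G ∧ 1 ≤ β ∧
    ∀ x ∈ G, ∃ (L : ℝ) (γ : ℝ → EuclideanSpace ℝ (Fin n)),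
      0 ≤ L ∧ L ≤ β * diam G ∧ γ 0 = x ∧ γ L = x₀ ∧
      (∀ t ∈ Icc 0 L, γ t ∈ G) ∧ LipschitzOnWith 1 γ (Icc 0 L) ∧
      ∀ t ∈ Icc 0 L, t / β ≤ infDist (γ t) (frontier G)

/-- The Aikawa dimension of `S` is strictly less than `d`. -/
def aikawaDimLT (n : ℕ) (S : Set (EuclideanSpace ℝ (Fin n))) (d : ℝ) : Prop :=
  ∃ t C₀ : ℝ, 0 < t ∧ t < d ∧ 0 < C₀ ∧
    ∀ x ∈ S, ∀ r : ℝ, 0 < r →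
      ∫⁻ y in ball x r, (ENNReal.ofReal (infDist y S)) ^ (t - (n : ℝ)) ≤
        ENNReal.ofReal (C₀ * r ^ t)

lemma frontier_nonempty_of_isBounded {n : ℕ} (hn : 2 ≤ n) {G : Set (EuclideanSpace ℝ (Fin n))}
    (hne : G.Nonempty) (hb : Bornology.IsBounded G) : (frontier G).Nonempty := by
  have : Nonempty (Fin n) := ⟨⟨0, by omega⟩⟩
  refine nonempty_frontier_iff.2 ⟨hne, fun h => ?_⟩
  exact NormedSpace.unbounded_univ ℝ (EuclideanSpace ℝ (Fin n)) (h ▸ hb)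

lemma infDist_frontier_pos {X : Type*} [PseudoMetricSpace X] {G : Set X} (hG : IsOpen G)
    (hne : (frontier G).Nonempty) {x : X} (hx : x ∈ G) : 0 < infDist x (frontier G) := by
  refine (isClosed_frontier.notMem_iff_infDist_pos hne).1 fun h => ?_
  rw [hG.frontier_eq] at h
  exact h.2 hx

lemma ball_subset_of_le_infDist_frontier {E : Type*} [NormedAddCommGroup E] [NormedSpace ℝ E]
    {G : Set E} (hG : IsOpen G) {z : E} {r : ℝ} (hz : z ∈ G) (hr : r ≤ infDist z (frontier G)) :
    ball z r ⊆ G := by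
  rcases le_or_gt r 0 with h0 | h0
  · simp [ball_eq_empty.2 h0]
  · refine (convex_ball z r).isPreconnected.subset_left_of_subset_union hG
      isClosed_closure.isOpen_compl (disjoint_compl_right_iff_subset.2 subset_closure)
      (fun v hv => ?_) ⟨z, mem_ball_self h0, hz⟩
    by_contra h
    rw [mem_union, not_or, notMem_compl_iff] at h
    have hvf : v ∈ frontier G := hG.frontier_eq ▸ ⟨h.2, h.1⟩
    have := infDist_le_dist_of_mem (x := z) hvf
    rw [mem_ball, dist_comm] at hv
    linarith

/-- The points of `G` at distance less than `2 * M * d x` from `x` whose distance to the frontier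
exceeds `M * d x / (2 * β)`, where `d` is the distance to the frontier. -/
def innerRegion {n : ℕ} (G : Set (EuclideanSpace ℝ (Fin n))) (β M : ℝ)
    (x : EuclideanSpace ℝ (Fin n)) : Set (EuclideanSpace ℝ (Fin n)) :=
  {y | y ∈ G ∧ dist x y < 2 * M * infDist x (frontier G) ∧
    M * infDist x (frontier G) / (2 * β) < infDist y (frontier G)}

lemma IsJohnDomain.exists_ball_subset_innerRegion {n : ℕ} {G : Set (EuclideanSpace ℝ (Fin n))}
    {β : ℝ} {x₀ : EuclideanSpace ℝ (Fin n)} (hJ : IsJohnDomain n G β x₀) {M : ℝ} (hM : 1 ≤ M)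
    {x : EuclideanSpace ℝ (Fin n)} (hx : x ∈ G)
    (hxd : infDist x (frontier G) ≤ infDist x₀ (frontier G) / (2 * M)) :
    ∃ z, ball z (M * infDist x (frontier G) / (2 * β)) ⊆ innerRegion G β M x := by
  obtain ⟨hG, -, -, -, hβ, hcurve⟩ := hJ
  obtain ⟨L, γ, hL0, -, hγ0, hγL, hγG, hγLip, hγd⟩ := hcurve x hx
  set d := infDist x (frontier G) with hd
  have hd0 : 0 ≤ d := infDist_nonneg
  have hx₀ : infDist x₀ (frontier G) ≤ d + dist x₀ x := infDist_le_infDist_add_dist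
  have hLx : dist x₀ x ≤ L := by
    have := hγLip.dist_le_mul L (right_mem_Icc.2 hL0) 0 (left_mem_Icc.2 hL0)
    simpa [hγ0, hγL, Real.dist_eq, abs_of_nonneg hL0] using this
  rw [le_div_iff₀ (by positivity)] at hxd
  have hMd : d ≤ M * d := by nlinarith
  have ht : M * d ∈ Icc 0 L := ⟨by positivity, by nlinarith⟩
  set z := γ (M * d) with hz
  have hzd : M * d / β ≤ infDist z (frontier G) := hγd _ ht
  have hzx : dist z x ≤ M * d := by
    have := hγLip.dist_le_mul (M * d) ht 0 (left_mem_Icc.2 hL0)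
    rw [hγ0] at this
    rwa [NNReal.coe_one, one_mul, Real.dist_eq, sub_zero, abs_of_nonneg ht.1] at this
  have hhalf : M * d / β = M * d / (2 * β) + M * d / (2 * β) := by field_simp; ring
  have hr0 : 0 ≤ M * d / (2 * β) := by have := ht.1; positivity
  have hr : M * d / (2 * β) ≤ M * d := div_le_self ht.1 (by linarith)
  refine ⟨z, fun y hy => ⟨?_, ?_, ?_⟩⟩
  · exact ball_subset_of_le_infDist_frontier hG (hγG _ ht) (by linarith) hy
  · rw [mem_ball] at hy
    have := dist_triangle_left x y z
    linarith [dist_comm y z]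
  · rw [mem_ball, dist_comm] at hy
    have : infDist z (frontier G) ≤ infDist y (frontier G) + dist z y :=
      infDist_le_infDist_add_dist
    linarith

lemma lintegral_innerRegion_le {n : ℕ} {G : Set (EuclideanSpace ℝ (Fin n))} {β M q t C₀ : ℝ}
    (hβ : 1 ≤ β) (hM : 1 ≤ M) (hq : 0 < q) (ht : 0 < t) (hC₀ : 0 < C₀)
    (hne : (frontier G).Nonempty)
    (hA : ∀ x ∈ frontier G, ∀ r : ℝ, 0 < r →
      ∫⁻ y in ball x r, (ENNReal.ofReal (infDist y (frontier G))) ^ (t - (n : ℝ)) ≤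
        ENNReal.ofReal (C₀ * r ^ t))
    {y : EuclideanSpace ℝ (Fin n)} (hy : 0 < infDist y (frontier G)) :
    ∫⁻ x in {x | 0 < infDist x (frontier G) ∧ y ∈ innerRegion G β M x},
        ENNReal.ofReal (infDist x (frontier G) ^ (-(n + q))) ≤
      ENNReal.ofReal (C₀ * (6 * β) ^ t * (3 * M) ^ (q + t) *
        infDist y (frontier G) ^ (-q)) := by
  set D := infDist y (frontier G) with hD
  obtain ⟨y', hy', hyy'⟩ := isClosed_frontier.exists_infDist_eq_dist hne y
  set T : Set (EuclideanSpace ℝ (Fin n)) :=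
    {x | 0 < infDist x (frontier G) ∧ y ∈ innerRegion G β M x} with hT
  have hTball : T ⊆ ball y' (6 * β * D) := by
    rintro x ⟨hx0, -, hxy, hxD⟩
    rw [div_lt_iff₀ (by positivity)] at hxD
    have := dist_triangle x y y'
    rw [mem_ball]
    nlinarith
  have hmeas : Measurable fun x : EuclideanSpace ℝ (Fin n) =>
      (ENNReal.ofReal (infDist x (frontier G))) ^ (t - (n : ℝ)) := by fun_prop
  have hTmeas : MeasurableSet T := by
    by_cases hyG : y ∈ G
    · have : T = {x | 0 < infDist x (frontier G) ∧ dist x y < 2 * M * infDist x (frontier G) ∧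
          M * infDist x (frontier G) / (2 * β) < infDist y (frontier G)} := by
        ext x; simp [hT, innerRegion, hyG]
      rw [this]
      measurability
    · have : T = ∅ := by ext x; simp [hT, innerRegion, hyG]
      simp [this]
  calc ∫⁻ x in T, ENNReal.ofReal (infDist x (frontier G) ^ (-(n + q)))
      ≤ ∫⁻ x in T, ENNReal.ofReal ((D / (3 * M)) ^ (-(q + t))) *
          (ENNReal.ofReal (infDist x (frontier G))) ^ (t - (n : ℝ)) := by
        refine setLIntegral_mono' hTmeas ?_
        rintro x ⟨hx0, -, hxy, -⟩
        rw [ENNReal.ofReal_rpow_of_pos hx0, ← ENNReal.ofReal_mul (by positivity)]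
        refine ENNReal.ofReal_le_ofReal ?_
        have hDx : D / (3 * M) ≤ infDist x (frontier G) := by
          have : infDist y (frontier G) ≤ infDist x (frontier G) + dist y x :=
            infDist_le_infDist_add_dist
          rw [div_le_iff₀ (by positivity)]
          rw [dist_comm] at hxy
          nlinarith
        rw [show -((n : ℝ) + q) = -(q + t) + (t - n) by ring, Real.rpow_add hx0]
        refine mul_le_mul_of_nonneg_right ?_ (by positivity)
        exact Real.rpow_le_rpow_of_nonpos (by positivity) hDx (by linarith)
    _ = ENNReal.ofReal ((D / (3 * M)) ^ (-(q + t))) *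
          ∫⁻ x in T, (ENNReal.ofReal (infDist x (frontier G))) ^ (t - (n : ℝ)) :=
        lintegral_const_mul _ hmeas
    _ ≤ ENNReal.ofReal ((D / (3 * M)) ^ (-(q + t))) *
          ENNReal.ofReal (C₀ * (6 * β * D) ^ t) := by
        gcongr
        exact (lintegral_mono_set hTball).trans (hA y' hy' _ (by positivity))
    _ = _ := by
        rw [← ENNReal.ofReal_mul (by positivity)]
        congr 1
        rw [Real.div_rpow hy.le (by positivity), Real.mul_rpow (by positivity) hy.le,
          Real.rpow_neg (by positivity : 0 ≤ 3 * M),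
          show -q = -(q + t) + t by ring, Real.rpow_add hy]
        field_simp

lemma abs_rpow_le_two_rpow_mul (a b : ℝ) {p : ℝ} (hp : 0 ≤ p) :
    |a| ^ p ≤ 2 ^ p * (|a - b| ^ p + |b| ^ p) := by
  have hmax : |a| ≤ 2 * max |a - b| |b| := by
    have : |a| ≤ |a - b| + |b| := by simpa using abs_add_le (a - b) b
    linarith [le_max_left |a - b| |b|, le_max_right |a - b| |b|]
  calc |a| ^ p ≤ (2 * max |a - b| |b|) ^ p := by gcongr
    _ = 2 ^ p * (max |a - b| |b|) ^ p := Real.mul_rpow (by positivity) (by positivity)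
    _ ≤ _ := by
      gcongr
      rcases max_choice |a - b| |b| with h | h <;> rw [h]
      · exact le_add_of_nonneg_right (by positivity)
      · exact le_add_of_nonneg_left (by positivity)

lemma abs_rpow_mul_infDist_rpow_le {n : ℕ} {G : Set (EuclideanSpace ℝ (Fin n))} {β M q p : ℝ}
    (hM : 0 < M) (hq : 0 < q) (hp : 0 < p) (f : EuclideanSpace ℝ (Fin n) → ℝ)
    {x y : EuclideanSpace ℝ (Fin n)} (hx : 0 < infDist x (frontier G))
    (hy : y ∈ innerRegion G β M x) :
    |f x| ^ p * infDist x (frontier G) ^ (-(n + q)) ≤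
      2 ^ p * (2 * M) ^ (n + q) * (|f x - f y| ^ p / ‖x - y‖ ^ (n + q)) +
        2 ^ p * (|f y| ^ p * infDist x (frontier G) ^ (-(n + q))) := by
  set d := infDist x (frontier G)
  have hkey : |f x - f y| ^ p * d ^ (-(n + q)) ≤
      (2 * M) ^ (n + q) * (|f x - f y| ^ p / ‖x - y‖ ^ (n + q)) := by
    rcases eq_or_ne x y with rfl | hxy
    · simp [Real.zero_rpow hp.ne']
    · have hpos : 0 < ‖x - y‖ := norm_pos_iff.2 (sub_ne_zero.2 hxy)
      have hle : ‖x - y‖ ≤ 2 * M * d := by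
        rw [← dist_eq_norm]; exact hy.2.1.le
      have h1 : ‖x - y‖ ^ (n + q) ≤ (2 * M) ^ (n + q) * d ^ (n + q) := by
        rw [← Real.mul_rpow (by positivity) hx.le]
        gcongr
      have h2 : d ^ (-(n + q)) ≤ (2 * M) ^ (n + q) / ‖x - y‖ ^ (n + q) := by
        rw [Real.rpow_neg hx.le, le_div_iff₀ (by positivity), inv_mul_le_iff₀ (by positivity)]
        linarith
      calc |f x - f y| ^ p * d ^ (-(n + q))
          ≤ |f x - f y| ^ p * ((2 * M) ^ (n + q) / ‖x - y‖ ^ (n + q)) := by gcongr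
        _ = _ := by ring
  calc |f x| ^ p * d ^ (-(n + q))
      ≤ 2 ^ p * (|f x - f y| ^ p + |f y| ^ p) * d ^ (-(n + q)) := by
        gcongr; exact abs_rpow_le_two_rpow_mul _ _ hp.le
    _ = 2 ^ p * (|f x - f y| ^ p * d ^ (-(n + q))) + 2 ^ p * (|f y| ^ p * d ^ (-(n + q))) := by
        ring
    _ ≤ _ := by
        rw [mul_assoc (2 ^ p)]
        gcongr

lemma measurableSet_innerRegion {n : ℕ} {G : Set (EuclideanSpace ℝ (Fin n))} (hG : IsOpen G)
    (β M : ℝ) : MeasurableSet {z : EuclideanSpace ℝ (Fin n) × EuclideanSpace ℝ (Fin n) |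
      z.2 ∈ innerRegion G β M z.1} := by
  have hnear : MeasurableSet {z : EuclideanSpace ℝ (Fin n) × EuclideanSpace ℝ (Fin n) |
      dist z.1 z.2 < 2 * M * infDist z.1 (frontier G)} :=
    measurableSet_lt (by fun_prop) (by fun_prop)
  have hdeep : MeasurableSet {z : EuclideanSpace ℝ (Fin n) × EuclideanSpace ℝ (Fin n) |
      M * infDist z.1 (frontier G) / (2 * β) < infDist z.2 (frontier G)} :=
    measurableSet_lt (by fun_prop) (by fun_prop)
  exact (measurable_snd hG.measurableSet).inter (hnear.inter hdeep)

lemma ofReal_abs_rpow_mul_le_lintegral_innerRegion {n : ℕ} {G : Set (EuclideanSpace ℝ (Fin n))}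
    {β : ℝ} {x₀ : EuclideanSpace ℝ (Fin n)} (hJ : IsJohnDomain n G β x₀) {M q p : ℝ}
    (hM : 1 ≤ M) (hn : 0 < n) (hq : 0 < q) (hp : 0 < p) (f : EuclideanSpace ℝ (Fin n) → ℝ)
    {x : EuclideanSpace ℝ (Fin n)} (hx : x ∈ G) (hd : 0 < infDist x (frontier G))
    (hxd : infDist x (frontier G) ≤ infDist x₀ (frontier G) / (2 * M)) :
    ENNReal.ofReal (volume.real (ball (0 : EuclideanSpace ℝ (Fin n)) 1) * (M / (2 * β)) ^ n) *
        ENNReal.ofReal (|f x| ^ p * infDist x (frontier G) ^ (-q)) ≤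
      ∫⁻ y in innerRegion G β M x,
        (ENNReal.ofReal (2 ^ p * (2 * M) ^ (n + q)) *
            ENNReal.ofReal (|f x - f y| ^ p / ‖x - y‖ ^ (n + q)) +
          ENNReal.ofReal (2 ^ p) *
            ENNReal.ofReal (|f y| ^ p * infDist x (frontier G) ^ (-(n + q)))) := by
  have : Nonempty (Fin n) := ⟨⟨0, hn⟩⟩
  obtain ⟨z, hz⟩ := hJ.exists_ball_subset_innerRegion hM hx hxd
  have hβ : 1 ≤ β := hJ.2.2.2.2.1
  set d := infDist x (frontier G)
  calc _ = ENNReal.ofReal (|f x| ^ p * d ^ (-(n + q))) * volume (ball z (M * d / (2 * β))) := by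
        rw [Measure.addHaar_ball _ _ (by positivity), finrank_euclideanSpace, Fintype.card_fin,
          ← ofReal_measureReal measure_ball_lt_top.ne, ← ENNReal.ofReal_mul (by positivity),
          ← ENNReal.ofReal_mul (by positivity), ← ENNReal.ofReal_mul (by positivity)]
        congr 1
        rw [neg_add, Real.rpow_add hd, Real.rpow_neg hd.le n, Real.rpow_natCast, mul_div_right_comm,
          mul_pow]
        field_simp
    _ ≤ ENNReal.ofReal (|f x| ^ p * d ^ (-(n + q))) * volume (innerRegion G β M x) := by
        gcongr
    _ = ∫⁻ y in innerRegion G β M x, ENNReal.ofReal (|f x| ^ p * d ^ (-(n + q))) := by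
        rw [setLIntegral_const]
    _ ≤ _ := by
        refine setLIntegral_mono'
          (measurable_prodMk_left (measurableSet_innerRegion hJ.1 β M)) fun y hy => ?_
        rw [← ENNReal.ofReal_mul (by positivity), ← ENNReal.ofReal_mul (by positivity),
          ← ENNReal.ofReal_add (by positivity) (by positivity)]
        exact ENNReal.ofReal_le_ofReal
          (abs_rpow_mul_infDist_rpow_le (by positivity) hq hp f hd hy)

/-- The estimate near the boundary which is absorbed when `M` is large. -/
lemma setLIntegral_hardy_le {n : ℕ} {G : Set (EuclideanSpace ℝ (Fin n))}
    {β : ℝ} {x₀ : EuclideanSpace ℝ (Fin n)} (hJ : IsJohnDomain n G β x₀) {M q p t C₀ η : ℝ}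
    (hM : 2 * β ≤ M) (hn : 0 < n) (hq : 0 < q) (hp : 0 < p) (ht : 0 < t) (hC₀ : 0 < C₀)
    (hne : (frontier G).Nonempty)
    (hA : ∀ x ∈ frontier G, ∀ r : ℝ, 0 < r →
      ∫⁻ y in ball x r, (ENNReal.ofReal (infDist y (frontier G))) ^ (t - (n : ℝ)) ≤
        ENNReal.ofReal (C₀ * r ^ t))
    (hη : 0 < η) {f : EuclideanSpace ℝ (Fin n) → ℝ} (hf : Measurable f) :
    ENNReal.ofReal (volume.real (ball (0 : EuclideanSpace ℝ (Fin n)) 1) * (M / (2 * β)) ^ n) *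
        ∫⁻ x in {x | x ∈ G ∧ η < infDist x (frontier G) ∧
            infDist x (frontier G) ≤ infDist x₀ (frontier G) / (2 * M)},
          ENNReal.ofReal (|f x| ^ p * infDist x (frontier G) ^ (-q)) ≤
      ENNReal.ofReal (2 ^ p * (2 * M) ^ (n + q)) * (∫⁻ x in G, ∫⁻ y in G,
          ENNReal.ofReal (|f x - f y| ^ p / ‖x - y‖ ^ (n + q))) +
        ENNReal.ofReal (2 ^ p * (C₀ * (6 * β) ^ t * (3 * M) ^ (q + t))) *
          ∫⁻ x in {x | x ∈ G ∧ η < infDist x (frontier G)},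
            ENNReal.ofReal (|f x| ^ p * infDist x (frontier G) ^ (-q)) := by
  have hβ : 1 ≤ β := hJ.2.2.2.2.1
  have hM1 : 1 ≤ M := by linarith
  have hGm : MeasurableSet G := hJ.1.measurableSet
  set d : EuclideanSpace ℝ (Fin n) → ℝ := fun x => infDist x (frontier G) with hd
  have hdm : Measurable d := by fun_prop
  set W : Set (EuclideanSpace ℝ (Fin n)) := {x | x ∈ G ∧ η < d x} with hW
  set V : Set (EuclideanSpace ℝ (Fin n)) := {x | x ∈ G ∧ η < d x ∧ d x ≤ d x₀ / (2 * M)} with hV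
  have hWm : MeasurableSet W := hGm.inter (measurableSet_lt measurable_const hdm)
  have hVm : MeasurableSet V := hGm.inter
    ((measurableSet_lt measurable_const hdm).inter (measurableSet_le hdm measurable_const))
  have hDm := measurableSet_innerRegion hJ.1 β M
  have hDx : ∀ x, MeasurableSet (innerRegion G β M x) := fun x => measurable_prodMk_left hDm
  set E : EuclideanSpace ℝ (Fin n) × EuclideanSpace ℝ (Fin n) → ℝ≥0∞ :=
    fun z => ENNReal.ofReal (|f z.1 - f z.2| ^ p / ‖z.1 - z.2‖ ^ (n + q)) with hE
  have hEm : Measurable E := by fun_prop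
  set F : EuclideanSpace ℝ (Fin n) × EuclideanSpace ℝ (Fin n) → ℝ≥0∞ :=
    {z | z.2 ∈ innerRegion G β M z.1}.indicator
      fun z => ENNReal.ofReal (|f z.2| ^ p * d z.1 ^ (-(n + q))) with hF
  have hFm : Measurable F := Measurable.indicator (by fun_prop) hDm
  calc _ = ∫⁻ x in V, ENNReal.ofReal (volume.real (ball (0 : EuclideanSpace ℝ (Fin n)) 1) *
          (M / (2 * β)) ^ n) * ENNReal.ofReal (|f x| ^ p * d x ^ (-q)) :=
        (lintegral_const_mul _ (by fun_prop)).symm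
    _ ≤ ∫⁻ x in V, (ENNReal.ofReal (2 ^ p * (2 * M) ^ (n + q)) * (∫⁻ y in G, E (x, y)) +
          ENNReal.ofReal (2 ^ p) * ∫⁻ y, F (x, y)) := by
        refine setLIntegral_mono' hVm fun x hx => ?_
        refine (ofReal_abs_rpow_mul_le_lintegral_innerRegion hJ hM1 hn hq hp f hx.1
          (hη.trans hx.2.1) hx.2.2).trans ?_
        rw [lintegral_add_left (by fun_prop), lintegral_const_mul _ (by fun_prop),
          lintegral_const_mul _ (by fun_prop)]
        refine add_le_add ?_ ?_
        · gcongr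
          exact fun y hy => hy.1
        · rw [← lintegral_indicator (hDx x)]
          exact le_of_eq rfl
    _ = ENNReal.ofReal (2 ^ p * (2 * M) ^ (n + q)) * (∫⁻ x in V, ∫⁻ y in G, E (x, y)) +
          ENNReal.ofReal (2 ^ p) * ∫⁻ x in V, ∫⁻ y, F (x, y) := by
        rw [lintegral_add_left (hEm.lintegral_prod_right'.const_mul _),
          lintegral_const_mul _ hEm.lintegral_prod_right',
          lintegral_const_mul _ hFm.lintegral_prod_right']
    _ ≤ _ := by
        refine add_le_add ?_ ?_
        · gcongr
          exact fun x hx => hx.1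
        rw [ENNReal.ofReal_mul (p := 2 ^ p) (by positivity), mul_assoc (ENNReal.ofReal (2 ^ p))]
        gcongr
        rw [lintegral_lintegral_swap (f := fun x y => F (x, y)) hFm.aemeasurable,
          ← lintegral_const_mul _ (by fun_prop), ← lintegral_indicator hWm]
        refine lintegral_mono fun y => ?_
        set T : Set (EuclideanSpace ℝ (Fin n)) := {x | 0 < d x ∧ y ∈ innerRegion G β M x} with hT
        have hTm : MeasurableSet T :=
          (measurableSet_lt measurable_const hdm).inter (measurable_prodMk_right hDm)
        by_cases hy : y ∈ W
        · rw [indicator_of_mem hy]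
          calc ∫⁻ x in V, F (x, y)
              ≤ ∫⁻ x in V, T.indicator
                  (fun x => ENNReal.ofReal (|f y| ^ p * d x ^ (-(n + q)))) x := by
                refine setLIntegral_mono' hVm fun x hx => ?_
                by_cases hxy : y ∈ innerRegion G β M x
                · rw [indicator_of_mem (show x ∈ T from ⟨hη.trans hx.2.1, hxy⟩)]
                  exact indicator_le_self _ _ _
                · simp [hF, hxy]
            _ ≤ ∫⁻ x, T.indicator
                  (fun x => ENNReal.ofReal (|f y| ^ p * d x ^ (-(n + q)))) x :=
                setLIntegral_le_lintegral _ _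
            _ = ENNReal.ofReal (|f y| ^ p) * ∫⁻ x in T, ENNReal.ofReal (d x ^ (-(n + q))) := by
                rw [lintegral_indicator hTm, ← lintegral_const_mul _ (by fun_prop)]
                simp_rw [← ENNReal.ofReal_mul (Real.rpow_nonneg (abs_nonneg (f y)) p)]
            _ ≤ ENNReal.ofReal (|f y| ^ p) * ENNReal.ofReal
                  (C₀ * (6 * β) ^ t * (3 * M) ^ (q + t) * d y ^ (-q)) := by
                gcongr
                exact lintegral_innerRegion_le hβ hM1 hq ht hC₀ hne hA (hη.trans hy.2)
            _ = _ := by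
                rw [← ENNReal.ofReal_mul (by positivity), ← ENNReal.ofReal_mul (by positivity)]
                congr 1
                ring
        · rw [indicator_of_notMem hy, nonpos_iff_eq_zero]
          refine (setLIntegral_congr_fun hVm fun x hx => ?_).trans lintegral_zero
          refine indicator_of_notMem (fun hxy => hy ⟨hxy.1, ?_⟩) _
          refine lt_of_le_of_lt ?_ hxy.2.2
          rw [le_div_iff₀ (by positivity)]
          nlinarith [hx.2.1]

lemma ENNReal.le_of_mul_le_add_half_mul {I A : ℝ≥0∞} {κ b : ℝ} (hκ : 0 < κ) (hb : b ≤ κ / 2)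
    (hI : I ≠ ⊤) (h : ENNReal.ofReal κ * I ≤ A + ENNReal.ofReal b * I) :
    I ≤ ENNReal.ofReal (2 / κ) * A := by
  have hb' : ENNReal.ofReal b * I ≤ ENNReal.ofReal (κ / 2) * I := by gcongr
  have hfin : ENNReal.ofReal (κ / 2) * I ≠ ⊤ := ENNReal.mul_ne_top ENNReal.ofReal_ne_top hI
  have hsplit : ENNReal.ofReal κ * I = ENNReal.ofReal (κ / 2) * I + ENNReal.ofReal (κ / 2) * I := by
    rw [← add_mul, ← ENNReal.ofReal_add (by positivity) (by positivity), add_halves]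
  have hle : ENNReal.ofReal (κ / 2) * I ≤ A := by
    refine (ENNReal.add_le_add_iff_right hfin).1 ?_
    rw [← hsplit]
    exact h.trans (by gcongr)
  calc I = ENNReal.ofReal (2 / κ) * (ENNReal.ofReal (κ / 2) * I) := by
        rw [← mul_assoc, ← ENNReal.ofReal_mul (by positivity)]
        field_simp
        simp
    _ ≤ _ := by gcongr

lemma exists_dilation_absorbing {n : ℕ} {ω β K q t : ℝ} (hω : 0 < ω) (hβ : 1 ≤ β)
    (htq : t < n - q) :
    ∃ M : ℝ, 2 * β ≤ M ∧ K * (3 * M) ^ (q + t) ≤ ω * (M / (2 * β)) ^ n / 2 := by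
  have hlim : Filter.Tendsto (fun M : ℝ => K * 3 ^ (q + t) * (2 * β) ^ n * M ^ (-(n - q - t)))
      Filter.atTop (nhds 0) := by
    simpa using (tendsto_rpow_neg_atTop (by linarith : 0 < n - q - t)).const_mul
      (K * 3 ^ (q + t) * (2 * β) ^ n)
  obtain ⟨M, hMlt, hM⟩ := ((hlim.eventually_lt_const (half_pos hω)).and
    (Filter.eventually_ge_atTop (2 * β))).exists
  refine ⟨M, hM, ?_⟩
  have hM0 : 0 < M := by linarith
  have hMn : M ^ (q + t) = M ^ (-(n - q - t)) * M ^ n := by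
    rw [← Real.rpow_natCast, ← Real.rpow_add hM0]
    congr 1
    ring
  rw [Real.mul_rpow (by norm_num) hM0.le, hMn, div_pow, mul_div_assoc', div_div,
    le_div_iff₀ (by positivity)]
  calc _ = 2 * (K * 3 ^ (q + t) * (2 * β) ^ n * M ^ (-(n - q - t))) * M ^ n := by ring
    _ ≤ 2 * (ω / 2) * M ^ n := by gcongr
    _ = _ := by ring

/-- The fractional Hardy inequality on a John domain with small boundary, without `p`-th roots. -/
lemma IsJohnDomain.exists_lintegral_hardy_le {n : ℕ} {G : Set (EuclideanSpace ℝ (Fin n))}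
    {β : ℝ} {x₀ : EuclideanSpace ℝ (Fin n)} (hJ : IsJohnDomain n G β x₀) {q p : ℝ}
    (hn : 2 ≤ n) (hq : 0 < q) (hp : 0 < p)
    (hdim : aikawaDimLT n (frontier G) ((n : ℝ) - q)) :
    ∃ C : ℝ, 0 < C ∧ ∀ f : EuclideanSpace ℝ (Fin n) → ℝ, Measurable f →
      (∫⁻ x in G, ENNReal.ofReal (|f x| ^ p)) < ⊤ →
      (∫⁻ x in G, ENNReal.ofReal (|f x| ^ p) *
          (ENNReal.ofReal (infDist x (frontier G))) ^ (-q)) ≤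
        ENNReal.ofReal C * ((∫⁻ x in G, ENNReal.ofReal (|f x| ^ p)) +
          ∫⁻ x in G, ∫⁻ y in G, ENNReal.ofReal (|f x - f y| ^ p / ‖x - y‖ ^ (n + q))) := by
  obtain ⟨t, C₀, ht, htq, hC₀, hA⟩ := hdim
  have hβ : 1 ≤ β := hJ.2.2.2.2.1
  have hG : IsOpen G := hJ.1
  have hne : (frontier G).Nonempty :=
    frontier_nonempty_of_isBounded hn hJ.2.1.nonempty hJ.2.2.1
  have hω : 0 < volume.real (ball (0 : EuclideanSpace ℝ (Fin n)) 1) :=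
    ENNReal.toReal_pos (measure_ball_pos _ _ one_pos).ne' measure_ball_lt_top.ne
  obtain ⟨M, hM, hMK⟩ := exists_dilation_absorbing (K := 2 ^ p * (C₀ * (6 * β) ^ t)) hω hβ htq
  have hM0 : 0 < M := by linarith
  set κ := volume.real (ball (0 : EuclideanSpace ℝ (Fin n)) 1) * (M / (2 * β)) ^ n with hκ
  have hκ0 : 0 < κ := by positivity
  set d : EuclideanSpace ℝ (Fin n) → ℝ := fun x => infDist x (frontier G) with hd
  have hdm : Measurable d := by fun_prop
  have hdpos : ∀ x ∈ G, 0 < d x := fun x hx => infDist_frontier_pos hG hne hx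
  set δ := d x₀ / (2 * M) with hδ
  have hδ0 : 0 < δ := div_pos (hdpos _ hJ.2.2.2.1) (by positivity)
  set a := max (2 ^ p * (2 * M) ^ (n + q)) (κ * δ ^ (-q)) with ha
  have ha0 : 0 < a := lt_max_of_lt_left (by positivity)
  refine ⟨2 / κ * a, by positivity, fun f hf hfin => ?_⟩
  set N := ∫⁻ x in G, ENNReal.ofReal (|f x| ^ p)
  set S := ∫⁻ x in G, ∫⁻ y in G, ENNReal.ofReal (|f x - f y| ^ p / ‖x - y‖ ^ (n + q))
  set W : ℝ → Set (EuclideanSpace ℝ (Fin n)) := fun η => {x | x ∈ G ∧ η < d x} with hW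
  have hWm : ∀ η, MeasurableSet (W η) := fun η =>
    hG.measurableSet.inter (measurableSet_lt measurable_const hdm)
  have hfar : ∀ η, 0 < η → ∫⁻ x in W η, ENNReal.ofReal (|f x| ^ p * d x ^ (-q)) ≤
      ENNReal.ofReal (η ^ (-q)) * N := by
    intro η hη
    rw [← lintegral_const_mul _ (by fun_prop)]
    refine le_trans (setLIntegral_mono' (hWm η) fun x hx => ?_)
      (lintegral_mono_set fun x hx => hx.1)
    rw [← ENNReal.ofReal_mul (by positivity), mul_comm (η ^ (-q))]
    refine ENNReal.ofReal_le_ofReal ?_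
    gcongr ?_ * ?_
    exact Real.rpow_le_rpow_of_nonpos hη hx.2.le (by linarith)
  have hbound : ∀ η, 0 < η → ∫⁻ x in W η, ENNReal.ofReal (|f x| ^ p * d x ^ (-q)) ≤
      ENNReal.ofReal (2 / κ * a) * (N + S) := by
    intro η hη
    have hI : ∫⁻ x in W η, ENNReal.ofReal (|f x| ^ p * d x ^ (-q)) ≠ ⊤ :=
      ((hfar η hη).trans_lt (ENNReal.mul_lt_top ENNReal.ofReal_lt_top hfin)).ne
    rw [ENNReal.ofReal_mul (by positivity), mul_assoc]
    refine ENNReal.le_of_mul_le_add_half_mul hκ0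
      (b := 2 ^ p * (C₀ * (6 * β) ^ t * (3 * M) ^ (q + t))) ?_ hI ?_
    · rw [← mul_assoc]
      exact hMK
    have hnear := setLIntegral_hardy_le hJ hM (by omega) hq hp ht hC₀ hne hA hη hf
    have hcover : W η ⊆ {x | x ∈ G ∧ η < d x ∧ d x ≤ δ} ∪ W δ := fun x hx =>
      (le_or_gt (d x) δ).imp (fun h => ⟨hx.1, hx.2, h⟩) fun h => ⟨hx.1, h⟩
    calc _ ≤ ENNReal.ofReal κ *
            ((∫⁻ x in {x | x ∈ G ∧ η < d x ∧ d x ≤ δ},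
              ENNReal.ofReal (|f x| ^ p * d x ^ (-q))) +
              ∫⁻ x in W δ, ENNReal.ofReal (|f x| ^ p * d x ^ (-q))) := by
          gcongr
          exact (lintegral_mono_set hcover).trans (lintegral_union_le _ _ _)
      _ ≤ (ENNReal.ofReal (2 ^ p * (2 * M) ^ (n + q)) * S +
            ENNReal.ofReal (2 ^ p * (C₀ * (6 * β) ^ t * (3 * M) ^ (q + t))) *
              ∫⁻ x in W η, ENNReal.ofReal (|f x| ^ p * d x ^ (-q))) +
            ENNReal.ofReal (κ * δ ^ (-q)) * N := by
          rw [mul_add, ENNReal.ofReal_mul hκ0.le, mul_assoc (ENNReal.ofReal κ)]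
          gcongr
          exact hfar δ hδ0
      _ ≤ (ENNReal.ofReal a * S +
            ENNReal.ofReal (2 ^ p * (C₀ * (6 * β) ^ t * (3 * M) ^ (q + t))) *
              ∫⁻ x in W η, ENNReal.ofReal (|f x| ^ p * d x ^ (-q))) +
            ENNReal.ofReal a * N := by
          gcongr
          · exact le_max_left _ _
          · exact le_max_right _ _
      _ = _ := by ring
  have hunion : G = ⋃ k : ℕ, W (1 / ((k : ℝ) + 1)) := by
    ext x
    refine ⟨fun hx => ?_, fun hx => ?_⟩
    · obtain ⟨k, hk⟩ := exists_nat_one_div_lt (hdpos x hx)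
      exact mem_iUnion.2 ⟨k, hx, hk⟩
    · obtain ⟨k, hk⟩ := mem_iUnion.1 hx
      exact hk.1
  have hmono : Monotone fun k : ℕ => W (1 / ((k : ℝ) + 1)) := fun i j hij x hx =>
    ⟨hx.1, (one_div_le_one_div_of_le (by positivity) (by gcongr)).trans_lt hx.2⟩
  calc _ = ∫⁻ x in G, ENNReal.ofReal (|f x| ^ p * d x ^ (-q)) := by
        refine setLIntegral_congr_fun hG.measurableSet fun x hx => ?_
        rw [ENNReal.ofReal_rpow_of_pos (hdpos x hx), ← ENNReal.ofReal_mul (by positivity)]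
    _ = ∫⁻ x in ⋃ k : ℕ, W (1 / ((k : ℝ) + 1)), ENNReal.ofReal (|f x| ^ p * d x ^ (-q)) := by
        rw [← hunion]
    _ ≤ _ := by
        rw [setLIntegral_iUnion_of_directed _ hmono.directed_le]
        exact iSup_le fun k => hbound _ (by positivity)

theorem stmt13 (n : ℕ) (hn : 2 ≤ n) (s p : ℝ) (hp : 1 < p)
    (hs0 : 0 < s) (hs1 : s < min 1 ((n : ℝ) / p))
    (G : Set (EuclideanSpace ℝ (Fin n))) (β : ℝ) (x₀ : EuclideanSpace ℝ (Fin n))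
    (hJohn : IsJohnDomain n G β x₀)
    (hdim : aikawaDimLT n (frontier G) ((n : ℝ) - s * p)) :
    ∃ C : ℝ, 0 < C ∧
      ∀ f : EuclideanSpace ℝ (Fin n) → ℝ, Measurable f →
        (∫⁻ x in G, ENNReal.ofReal (|f x| ^ p)) < ⊤ →
        (∫⁻ x in G, ENNReal.ofReal (|f x| ^ p) *
            (ENNReal.ofReal (infDist x (frontier G))) ^ (-(s * p))) ^ (1 / p)
          ≤ ENNReal.ofReal C *
            ((∫⁻ x in G, ENNReal.ofReal (|f x| ^ p)) ^ (1 / p) +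
              (∫⁻ x in G, ∫⁻ y in G,
                ENNReal.ofReal (|f x - f y| ^ p / ‖x - y‖ ^ ((n : ℝ) + s * p))) ^ (1 / p)) := by
  have hp0 : 0 < p := by linarith
  obtain ⟨C, hC, hH⟩ :=
    hJohn.exists_lintegral_hardy_le hn (mul_pos hs0 hp0) hp0 hdim
  refine ⟨C ^ (1 / p), by positivity, fun f hf hfin => ?_⟩
  refine (ENNReal.rpow_le_rpow (hH f hf hfin) (by positivity)).trans ?_
  rw [ENNReal.mul_rpow_of_nonneg _ _ (by positivity), ENNReal.ofReal_rpow_of_pos hC]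
  gcongr
  exact ENNReal.rpow_add_le_add_rpow _ _ (by positivity) ((div_le_one hp0).2 hp.le)
end
end

section
/- Suppose G ⊂ ℝⁿ is a domain with compact boundary such that ℝⁿ\G has Lebesgue measure zero, and suppose the Hardy inequality (∫_G |f|^p dist(x,∂G)^{−sp} dx)^{1/p} ≤ C ‖f‖_{W^{s,p}(G)} holds for all f ∈ W^{s,p}(G), where 0<s<1, 1<p<∞, sp<n. Then there is a constant C' such that for every x ∈ ∂G and 0 < r ≤ 1, ∫_{B(x,r/2)} dist(y,∂G)^{−sp} dy ≤ C' r^{n−sp}. -/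
open MeasureTheory Metric Set
open scoped ENNReal

noncomputable section

/-- The `p`-th power `L^p` integral of `f` over `A`. -/
def lpInt (n : ℕ) (p : ℝ) (A : Set (EuclideanSpace ℝ (Fin n)))
    (f : EuclideanSpace ℝ (Fin n) → ℝ) : ℝ≥0∞ :=
  ∫⁻ x in A, ENNReal.ofReal (|f x| ^ p)

/-- The `p`-th power of the Gagliardo seminorm of `f` over `A`. -/
def gagliardo (n : ℕ) (s p : ℝ) (A : Set (EuclideanSpace ℝ (Fin n)))
    (f : EuclideanSpace ℝ (Fin n) → ℝ) : ℝ≥0∞ :=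
  ∫⁻ x in A, ∫⁻ y in A, ENNReal.ofReal (|f x - f y| ^ p / ‖x - y‖ ^ ((n : ℝ) + s * p))

/-- The `W^{s,p}(A)` norm of `f`. -/
def sobNorm (n : ℕ) (s p : ℝ) (A : Set (EuclideanSpace ℝ (Fin n)))
    (f : EuclideanSpace ℝ (Fin n) → ℝ) : ℝ≥0∞ :=
  (lpInt n p A f) ^ (1 / p) + (gagliardo n s p A f) ^ (1 / p)

/-- The radial majorant `min(1, 2t)^p / t^q` of the Gagliardo kernel of a cutoff at unit scale. -/
def cutoffKernel (p q t : ℝ) : ℝ := min 1 (2 * t) ^ p / t ^ q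

/-- The Lipschitz cutoff equal to `1` on `ball x (r / 2)` and to `0` off `ball x r`. -/
def cutoff {E : Type*} [PseudoMetricSpace E] (x : E) (r : ℝ) (y : E) : ℝ :=
  max 0 (min 1 (2 - 2 * (r⁻¹ * dist y x)))

lemma measurable_cutoffKernel (p q : ℝ) : Measurable (cutoffKernel p q) := by
  unfold cutoffKernel
  fun_prop

lemma cutoffKernel_nonneg {p q t : ℝ} (ht : 0 ≤ t) : 0 ≤ cutoffKernel p q t := by
  unfold cutoffKernel
  positivity

lemma integrable_cutoffKernel_norm {E : Type*} [NormedAddCommGroup E] [NormedSpace ℝ E]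
    [FiniteDimensional ℝ E] [Nontrivial E] [MeasurableSpace E] [BorelSpace E]
    (μ : Measure E) [μ.IsAddHaarMeasure] {p a : ℝ} (ha : 0 < a) (hap : a < p) :
    Integrable (fun h : E => cutoffKernel p (Module.finrank ℝ E + a) ‖h‖) μ := by
  have hd : 1 ≤ Module.finrank ℝ E := Module.finrank_pos
  have hmeas : Measurable fun t : ℝ => t ^ (Module.finrank ℝ E - 1) •
      cutoffKernel p (Module.finrank ℝ E + a) t :=
    (measurable_id.pow_const _).smul (measurable_cutoffKernel _ _)
  have hsplit : ∀ {t b : ℝ}, 0 < t →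
      t ^ (Module.finrank ℝ E - 1) * (t ^ b / t ^ ((Module.finrank ℝ E : ℝ) + a))
        = t ^ (b - a - 1) := by
    intro t b ht
    rw [← Real.rpow_natCast, ← Real.rpow_sub ht, ← Real.rpow_add ht, Nat.cast_sub hd]
    congr 1
    push_cast
    ring
  rw [integrable_fun_norm_addHaar, ← Ioc_union_Ioi_eq_Ioi zero_le_one, integrableOn_union]
  constructor
  · have hint : IntegrableOn (fun t : ℝ => 2 ^ p * t ^ (p - a - 1)) (Ioc 0 1) := by
      have := intervalIntegral.intervalIntegrable_rpow' (a := 0) (b := 1)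
        (show -1 < p - a - 1 by linarith)
      rw [intervalIntegrable_iff_integrableOn_Ioc_of_le zero_le_one] at this
      exact this.const_mul _
    refine Integrable.mono' hint hmeas.aestronglyMeasurable ?_
    filter_upwards [ae_restrict_mem measurableSet_Ioc] with t ht
    have h0 : 0 < t := ht.1
    rw [Real.norm_of_nonneg (smul_nonneg (by positivity) (cutoffKernel_nonneg h0.le)),
      ← hsplit h0, smul_eq_mul, cutoffKernel]
    have : min 1 (2 * t) ^ p ≤ 2 ^ p * t ^ p := by
      rw [← Real.mul_rpow two_pos.le h0.le]
      exact Real.rpow_le_rpow (by positivity) (min_le_right _ _) (by linarith)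
    calc _ ≤ t ^ (Module.finrank ℝ E - 1) *
          (2 ^ p * t ^ p / t ^ ((Module.finrank ℝ E : ℝ) + a)) := by gcongr
      _ = _ := by ring
  · have hint : IntegrableOn (fun t : ℝ => t ^ (0 - a - 1)) (Ioi 1) :=
      integrableOn_Ioi_rpow_of_lt (by linarith) one_pos
    refine Integrable.mono' hint hmeas.aestronglyMeasurable ?_
    filter_upwards [ae_restrict_mem measurableSet_Ioi] with t ht
    have h0 : 0 < t := one_pos.trans ht
    rw [Real.norm_of_nonneg (smul_nonneg (by positivity) (cutoffKernel_nonneg h0.le)),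
      ← hsplit h0, smul_eq_mul, cutoffKernel, Real.rpow_zero]
    have : min 1 (2 * t) ^ p ≤ 1 :=
      Real.rpow_le_one (by positivity) (min_le_left _ _) (by linarith)
    gcongr

section Cutoff

variable {E : Type*} [PseudoMetricSpace E] {x : E} {r : ℝ}

lemma cutoff_nonneg (y : E) : 0 ≤ cutoff x r y := le_max_left _ _

lemma cutoff_le_one (y : E) : cutoff x r y ≤ 1 := max_le zero_le_one (min_le_left _ _)

lemma cutoff_eq_one (hr : 0 < r) {y : E} (hy : y ∈ ball x (r / 2)) : cutoff x r y = 1 := by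
  have h : r⁻¹ * dist y x ≤ 1 / 2 := by
    rw [inv_mul_le_iff₀ hr]
    linarith [mem_ball.1 hy]
  rw [cutoff, min_eq_left (by linarith), max_eq_right zero_le_one]

lemma cutoff_eq_zero (hr : 0 < r) {y : E} (hy : y ∉ ball x r) : cutoff x r y = 0 := by
  have h : 1 ≤ r⁻¹ * dist y x := by
    rw [le_inv_mul_iff₀ hr]
    linarith [not_lt.1 (mt mem_ball.2 hy)]
  exact max_eq_left ((min_le_right _ _).trans (by linarith))

lemma abs_cutoff_sub_le (hr : 0 < r) (y z : E) :
    |cutoff x r y - cutoff x r z| ≤ min 1 (2 * (r⁻¹ * dist y z)) := by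
  refine le_min (abs_sub_le_iff.2 ⟨?_, ?_⟩) ?_
  · linarith [cutoff_le_one (x := x) (r := r) y, cutoff_nonneg (x := x) (r := r) z]
  · linarith [cutoff_le_one (x := x) (r := r) z, cutoff_nonneg (x := x) (r := r) y]
  · calc |cutoff x r y - cutoff x r z|
        ≤ |(2 - 2 * (r⁻¹ * dist y x)) - (2 - 2 * (r⁻¹ * dist z x))| := by
          unfold cutoff
          refine (abs_max_sub_max_le_max _ _ _ _).trans (max_le (by simp) ?_)
          exact (abs_min_sub_min_le_max _ _ _ _).trans (max_le (by simp) le_rfl)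
      _ = 2 * (r⁻¹ * |dist y x - dist z x|) := by
          rw [show (2 - 2 * (r⁻¹ * dist y x)) - (2 - 2 * (r⁻¹ * dist z x))
            = -(2 * r⁻¹ * (dist y x - dist z x)) by ring, abs_neg, abs_mul,
            abs_of_pos (by positivity), mul_assoc]
      _ ≤ 2 * (r⁻¹ * dist y z) := by
          gcongr
          exact abs_dist_sub_le y z x

lemma measurable_cutoff [MeasurableSpace E] [OpensMeasurableSpace E] :
    Measurable (cutoff x r) := by
  unfold cutoff
  fun_prop

end Cutoff

lemma cutoff_gagliardo_integrand_le {E : Type*} [NormedAddCommGroup E] [NormedSpace ℝ E]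
    {p q r : ℝ} (hp : 0 < p) (hr : 0 < r) (x y z : E) :
    ENNReal.ofReal (|cutoff x r y - cutoff x r z| ^ p / ‖y - z‖ ^ q) ≤
      ((ball x r).indicator 1 y + (ball x r).indicator 1 z) *
        (ENNReal.ofReal (r ^ (-q)) * ENNReal.ofReal (cutoffKernel p q ‖r⁻¹ • (y - z)‖)) := by
  by_cases hyz : y ∉ ball x r ∧ z ∉ ball x r
  · rw [cutoff_eq_zero hr hyz.1, cutoff_eq_zero hr hyz.2]
    simp [Real.zero_rpow hp.ne']
  have hone : (1 : ℝ≥0∞) ≤ (ball x r).indicator 1 y + (ball x r).indicator 1 z := by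
    by_cases hy : y ∈ ball x r
    · simp [hy]
    · have hz : z ∈ ball x r := by tauto
      simp [hz]
  refine le_trans ?_ (le_mul_of_one_le_left (by positivity) hone)
  rw [← ENNReal.ofReal_mul (by positivity)]
  refine ENNReal.ofReal_le_ofReal ?_
  rw [cutoffKernel, norm_smul, Real.norm_of_nonneg (by positivity),
    Real.mul_rpow (by positivity) (norm_nonneg _), Real.inv_rpow hr.le, Real.rpow_neg hr.le,
    ← dist_eq_norm]
  calc _ ≤ min 1 (2 * (r⁻¹ * dist y z)) ^ p / dist y z ^ q := by
        gcongr
        exact abs_cutoff_sub_le hr y z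
    _ = _ := by
        have : r ^ q ≠ 0 := (Real.rpow_pos_of_pos hr q).ne'
        field_simp

lemma lintegral_comp_inv_smul {E : Type*} [NormedAddCommGroup E] [NormedSpace ℝ E]
    [FiniteDimensional ℝ E] [MeasurableSpace E] [BorelSpace E]
    (μ : Measure E) [μ.IsAddHaarMeasure] {g : E → ℝ≥0∞} (hg : Measurable g)
    {r : ℝ} (hr : 0 < r) :
    ∫⁻ h, g (r⁻¹ • h) ∂μ = ENNReal.ofReal (r ^ Module.finrank ℝ E) * ∫⁻ h, g h ∂μ := by
  rw [← lintegral_map hg (measurable_const_smul r⁻¹),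
    Measure.map_addHaar_smul μ (inv_ne_zero hr.ne'), lintegral_smul_measure, smul_eq_mul]
  congr 2
  rw [inv_pow, inv_inv, abs_of_pos (by positivity)]

lemma lintegral_lintegral_cutoff_le {E : Type*} [NormedAddCommGroup E] [NormedSpace ℝ E]
    [FiniteDimensional ℝ E] [MeasurableSpace E] [BorelSpace E]
    (μ : Measure E) [μ.IsAddHaarMeasure] {p q r : ℝ} (hp : 0 < p) (hr : 0 < r) (x : E) :
    ∫⁻ y, ∫⁻ z, ENNReal.ofReal (|cutoff x r y - cutoff x r z| ^ p / ‖y - z‖ ^ q) ∂μ ∂μ ≤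
      2 * (μ (ball x r) * (ENNReal.ofReal (r ^ (-q)) * (ENNReal.ofReal (r ^ Module.finrank ℝ E) *
        ∫⁻ h, ENNReal.ofReal (cutoffKernel p q ‖h‖) ∂μ))) := by
  set k : E → ℝ≥0∞ := fun h => ENNReal.ofReal (cutoffKernel p q ‖h‖) with hk
  set c : ℝ≥0∞ := ENNReal.ofReal (r ^ (-q)) with hc
  set I : E → ℝ≥0∞ := (ball x r).indicator 1 with hI
  have hkm : Measurable k := ((measurable_cutoffKernel p q).comp measurable_norm).ennreal_ofReal
  have hIm : Measurable I := measurable_one.indicator measurableSet_ball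
  have hIint : ∫⁻ y, I y ∂μ = μ (ball x r) := by
    rw [hI, lintegral_indicator_one measurableSet_ball]
  have hkey : ∀ y, ∫⁻ z, c * k (r⁻¹ • (y - z)) ∂μ =
      c * (ENNReal.ofReal (r ^ Module.finrank ℝ E) * ∫⁻ h, k h ∂μ) := by
    intro y
    rw [lintegral_const_mul _ (by fun_prop),
      lintegral_sub_left_eq_self (fun h => k (r⁻¹ • h)) y, lintegral_comp_inv_smul μ hkm hr]
  have hsymm : ∀ y z, k (r⁻¹ • (y - z)) = k (r⁻¹ • (z - y)) := by
    intro y z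
    simp only [hk, norm_smul, norm_sub_rev y z]
  have hfirst : ∫⁻ y, ∫⁻ z, I y * (c * k (r⁻¹ • (y - z))) ∂μ ∂μ =
      μ (ball x r) * (c * (ENNReal.ofReal (r ^ Module.finrank ℝ E) * ∫⁻ h, k h ∂μ)) := by
    have : ∀ y, ∫⁻ z, I y * (c * k (r⁻¹ • (y - z))) ∂μ =
        I y * (c * (ENNReal.ofReal (r ^ Module.finrank ℝ E) * ∫⁻ h, k h ∂μ)) := by
      intro y
      rw [lintegral_const_mul _ (by fun_prop), hkey]
    simp_rw [this]
    rw [lintegral_mul_const _ hIm, hIint]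
  have hsecond : ∫⁻ y, ∫⁻ z, I z * (c * k (r⁻¹ • (y - z))) ∂μ ∂μ =
      μ (ball x r) * (c * (ENNReal.ofReal (r ^ Module.finrank ℝ E) * ∫⁻ h, k h ∂μ)) := by
    rw [lintegral_lintegral_swap, ← hfirst]
    · simp_rw [hsymm]
    · refine Measurable.aemeasurable ?_
      unfold Function.uncurry
      fun_prop
  calc _ ≤ ∫⁻ y, ∫⁻ z, (I y + I z) * (c * k (r⁻¹ • (y - z))) ∂μ ∂μ :=
        lintegral_mono fun y => lintegral_mono fun z =>
          cutoff_gagliardo_integrand_le hp hr x y z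
    _ = ∫⁻ y, (∫⁻ z, I y * (c * k (r⁻¹ • (y - z))) ∂μ +
          ∫⁻ z, I z * (c * k (r⁻¹ • (y - z))) ∂μ) ∂μ := by
        refine lintegral_congr fun y => ?_
        simp_rw [add_mul]
        exact lintegral_add_left (by fun_prop) _
    _ = _ := by
        rw [lintegral_add_left, hfirst, hsecond, two_mul]
        refine Measurable.lintegral_prod_right' (f := fun w : E × E =>
          I w.1 * (c * k (r⁻¹ • (w.1 - w.2)))) ?_
        fun_prop

lemma lintegral_cutoff_le {E : Type*} [PseudoMetricSpace E] [MeasurableSpace E]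
    [OpensMeasurableSpace E] (μ : Measure E) {p r : ℝ} (hp : 0 < p) (hr : 0 < r) (x : E) :
    ∫⁻ y, ENNReal.ofReal (|cutoff x r y| ^ p) ∂μ ≤ μ (ball x r) := by
  rw [← lintegral_indicator_one measurableSet_ball]
  refine lintegral_mono fun y => ?_
  by_cases hy : y ∈ ball x r
  · rw [indicator_of_mem hy, abs_of_nonneg (cutoff_nonneg y)]
    exact ENNReal.ofReal_le_one.2 (Real.rpow_le_one (cutoff_nonneg y) (cutoff_le_one y) hp.le)
  · simp [cutoff_eq_zero hr hy, Real.zero_rpow hp.ne']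

lemma exists_sobolev_cutoff_bound (n : ℕ) {s p : ℝ} (hs0 : 0 < s) (hs1 : s < 1) (hp : 1 < p)
    (hsp : s * p < n) :
    ∃ M : ℝ, 0 ≤ M ∧ ∀ (x : EuclideanSpace ℝ (Fin n)) (r : ℝ), 0 < r → r ≤ 1 →
      lpInt n p univ (cutoff x r) ≤ ENNReal.ofReal (M * r ^ ((n : ℝ) - s * p)) ∧
      gagliardo n s p univ (cutoff x r) ≤ ENNReal.ofReal (M * r ^ ((n : ℝ) - s * p)) := by
  have hp0 : 0 < p := by linarith
  have hsp0 : 0 < s * p := by positivity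
  have hn : 0 < n := by exact_mod_cast hsp0.trans hsp
  have : Nonempty (Fin n) := ⟨⟨0, hn⟩⟩
  set E := EuclideanSpace ℝ (Fin n)
  have hfin : Module.finrank ℝ E = n := finrank_euclideanSpace_fin
  have hint := integrable_cutoffKernel_norm (volume : Measure E) hsp0
    (show s * p < p by nlinarith)
  rw [hfin] at hint
  set V : ℝ := (volume (ball (0 : E) 1)).toReal
  have hV : volume (ball (0 : E) 1) = ENNReal.ofReal V :=
    (ENNReal.ofReal_toReal measure_ball_lt_top.ne).symm
  have hV0 : 0 ≤ V := ENNReal.toReal_nonneg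
  set K : ℝ := ∫ h : E, cutoffKernel p (n + s * p) ‖h‖
  have hK0 : 0 ≤ K := integral_nonneg fun h => cutoffKernel_nonneg (norm_nonneg h)
  have hK : ∫⁻ h : E, ENNReal.ofReal (cutoffKernel p (n + s * p) ‖h‖) = ENNReal.ofReal K :=
    (ofReal_integral_eq_lintegral_ofReal hint
      (.of_forall fun h => cutoffKernel_nonneg (norm_nonneg h))).symm
  refine ⟨V + 2 * (V * K), by positivity, fun x r hr hr1 => ⟨?_, ?_⟩⟩
  · rw [lpInt, Measure.restrict_univ]
    refine (lintegral_cutoff_le volume hp0 hr x).trans ?_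
    rw [Measure.addHaar_ball_of_pos _ _ hr, hfin, hV, ← ENNReal.ofReal_mul (by positivity)]
    refine ENNReal.ofReal_le_ofReal ?_
    have h1 : r ^ n ≤ r ^ ((n : ℝ) - s * p) := by
      rw [← Real.rpow_natCast]
      exact Real.rpow_le_rpow_of_exponent_ge hr hr1 (by linarith)
    calc r ^ n * V ≤ r ^ ((n : ℝ) - s * p) * (V + 2 * (V * K)) := by
          gcongr
          exact le_add_of_nonneg_right (by positivity)
      _ = _ := mul_comm _ _
  · rw [gagliardo, Measure.restrict_univ]
    refine (lintegral_lintegral_cutoff_le volume hp0 hr x).trans ?_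
    rw [Measure.addHaar_ball_of_pos _ _ hr, hfin, hV, hK, ← ENNReal.ofReal_mul (by positivity),
      ← ENNReal.ofReal_mul (by positivity), ← ENNReal.ofReal_mul (by positivity),
      ← ENNReal.ofReal_mul (by positivity),
      show (2 : ℝ≥0∞) = ENNReal.ofReal 2 by simp, ← ENNReal.ofReal_mul (by positivity)]
    refine ENNReal.ofReal_le_ofReal ?_
    have h1 : r ^ n * r ^ (-((n : ℝ) + s * p)) * r ^ n = r ^ ((n : ℝ) - s * p) := by
      rw [← Real.rpow_natCast, ← Real.rpow_add hr, ← Real.rpow_add hr]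
      congr 1
      ring
    calc _ = r ^ n * r ^ (-((n : ℝ) + s * p)) * r ^ n * (2 * (V * K)) := by ring
      _ = r ^ ((n : ℝ) - s * p) * (2 * (V * K)) := by rw [h1]
      _ ≤ r ^ ((n : ℝ) - s * p) * (V + 2 * (V * K)) := by
          gcongr
          exact le_add_of_nonneg_left hV0
      _ = _ := mul_comm _ _

theorem stmt16 (n : ℕ) (s p : ℝ) (hs0 : 0 < s) (hs1 : s < 1) (hp : 1 < p)
    (hsp : s * p < n)
    (G : Set (EuclideanSpace ℝ (Fin n))) (hGo : IsOpen G) (hGc : IsConnected G)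
    (hfr : IsCompact (frontier G)) (hnull : volume Gᶜ = 0)
    (C : ℝ) (hC : 0 < C)
    (hHardy : ∀ f : EuclideanSpace ℝ (Fin n) → ℝ, Measurable f →
      (∫⁻ x in G, ENNReal.ofReal (|f x| ^ p) *
          (ENNReal.ofReal (infDist x (frontier G))) ^ (-(s * p))) ^ (1 / p)
        ≤ ENNReal.ofReal C * sobNorm n s p G f) :
    ∃ C' : ℝ, 0 < C' ∧ ∀ x ∈ frontier G, ∀ r : ℝ, 0 < r → r ≤ 1 →
      ∫⁻ y in ball x (r / 2), (ENNReal.ofReal (infDist y (frontier G))) ^ (-(s * p))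
        ≤ ENNReal.ofReal (C' * r ^ ((n : ℝ) - s * p)) := by
  have hp0 : 0 < p := by linarith
  obtain ⟨M, hM0, hM⟩ := exists_sobolev_cutoff_bound n hs0 hs1 hp hsp
  refine ⟨(C * 2) ^ p * M + 1, by positivity, fun x _ r hr hr1 => ?_⟩
  have hG : (volume : Measure (EuclideanSpace ℝ (Fin n))).restrict G = volume :=
    Measure.restrict_eq_self_of_ae_mem (mem_ae_iff.2 hnull)
  have hH := hHardy (cutoff x r) measurable_cutoff
  obtain ⟨hL, hS⟩ := hM x r hr hr1
  simp only [sobNorm, lpInt, gagliardo, hG, Measure.restrict_univ] at hH hL hS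
  set D : EuclideanSpace ℝ (Fin n) → ℝ≥0∞ := fun y =>
    (ENNReal.ofReal (infDist y (frontier G))) ^ (-(s * p))
  set R : ℝ := r ^ ((n : ℝ) - s * p)
  have hR0 : 0 ≤ R := by positivity
  have hroot : (∫⁻ y, ENNReal.ofReal (|cutoff x r y| ^ p) * D y) ^ (1 / p) ≤
      ENNReal.ofReal (C * 2) * ENNReal.ofReal (M * R) ^ (1 / p) := by
    refine hH.trans ?_
    rw [ENNReal.ofReal_mul hC.le, mul_assoc, ENNReal.ofReal_ofNat, two_mul]
    gcongr
  calc ∫⁻ y in ball x (r / 2), D y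
      = ∫⁻ y in ball x (r / 2), ENNReal.ofReal (|cutoff x r y| ^ p) * D y := by
        refine setLIntegral_congr_fun measurableSet_ball fun y hy => ?_
        simp [cutoff_eq_one hr hy]
    _ ≤ ∫⁻ y, ENNReal.ofReal (|cutoff x r y| ^ p) * D y := setLIntegral_le_lintegral _ _
    _ = ((∫⁻ y, ENNReal.ofReal (|cutoff x r y| ^ p) * D y) ^ (1 / p)) ^ p := by
        rw [← ENNReal.rpow_mul, one_div_mul_cancel hp0.ne', ENNReal.rpow_one]
    _ ≤ (ENNReal.ofReal (C * 2) * ENNReal.ofReal (M * R) ^ (1 / p)) ^ p := by gcongr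
    _ = ENNReal.ofReal ((C * 2) ^ p * M * R) := by
        rw [ENNReal.mul_rpow_of_nonneg _ _ hp0.le, ← ENNReal.rpow_mul,
          one_div_mul_cancel hp0.ne', ENNReal.rpow_one,
          ENNReal.ofReal_rpow_of_nonneg (by positivity) hp0.le,
          ← ENNReal.ofReal_mul (by positivity), mul_assoc]
    _ ≤ _ := by
        refine ENNReal.ofReal_le_ofReal ?_
        gcongr
        linarith
end
end
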